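/- arXiv:1004.1018 — 2 statements merged into one kernel-verified Lean document; each statement's English description precedes it below -/
import Mathlib

section
/- Let z ∈ ℂⁿ with Σ_{j=1}ⁿ |z_j|² = 1, set t := ξ₀(|1 − Re z₁|), and define ξ(z) := t·z + (t−1)·e₁ ∈ ℂⁿ. Then ‖ξ(z)‖² = 2·(Re z₁ + 1)·(t² − t) + 1, and ξ(z) ≠ 0 (equivalently ‖ξ(z)‖ > 0). -/
/-- The cut-off function `ξ₀(x) = exp(−4/x²)` for `x > 0`, `ξ₀(x) = 0` for `x ≤ 0`. -/
noncomputable def xi0 : ℝ → ℝ := fun x => if 0 < x then Real.exp (-4 / x ^ 2) else 0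

theorem EuclideanSpace.norm_smul_add_smul_single_sq {ι : Type*} [Fintype ι] [DecidableEq ι]
    (z : EuclideanSpace ℂ ι) (hz : ‖z‖ = 1) (i : ι) (t : ℝ) :
    ‖(t : ℂ) • z + ((t : ℂ) - 1) • EuclideanSpace.single i (1 : ℂ)‖ ^ 2
      = 2 * ((z i).re + 1) * (t ^ 2 - t) + 1 := by
  have hs : ((t : ℂ) - 1) = ((t - 1 : ℝ) : ℂ) := by push_cast; rfl
  rw [hs, norm_add_sq (𝕜 := ℂ), inner_smul_left, inner_smul_right,
    EuclideanSpace.inner_single_right, norm_smul, norm_smul, hz]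
  simp only [Complex.norm_real, Real.norm_eq_abs, mul_pow, sq_abs, PiLp.norm_single,
    norm_one, Complex.conj_ofReal, one_mul, RCLike.re_to_complex, Complex.re_ofReal_mul, Complex.conj_re]
  ring

/-- for `z` on the unit sphere of `ℂⁿ` and `t := ξ₀(|1 − Re z₁|)`, the vector
`ξ(z) := t·z + (t − 1)·e₁` satisfies `‖ξ(z)‖² = 2(Re z₁ + 1)(t² − t) + 1` and `ξ(z) ≠ 0`. -/
theorem stmt3 (n : ℕ) (hn : 1 ≤ n) (z : EuclideanSpace ℂ (Fin n)) (hz : ‖z‖ = 1) :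
    let t : ℝ := xi0 |1 - (z ⟨0, hn⟩).re|
    let ξ : EuclideanSpace ℂ (Fin n) :=
      (t : ℂ) • z + ((t : ℂ) - 1) • EuclideanSpace.single ⟨0, hn⟩ (1 : ℂ)
    ‖ξ‖ ^ 2 = 2 * ((z ⟨0, hn⟩).re + 1) * (t ^ 2 - t) + 1 ∧ ξ ≠ 0 := by
  intro t ξ
  have key : ‖ξ‖ ^ 2 = 2 * ((z ⟨0, hn⟩).re + 1) * (t ^ 2 - t) + 1 :=
    EuclideanSpace.norm_smul_add_smul_single_sq z hz ⟨0, hn⟩ t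
  refine ⟨key, fun h0 => ?_⟩
  rw [h0, norm_zero] at key
  have habs : |(z ⟨0, hn⟩).re| ≤ 1 :=
    (Complex.abs_re_le_norm _).trans ((PiLp.norm_apply_le z _).trans hz.le)
  obtain ⟨hlo, hhi⟩ := abs_le.mp habs
  rcases hhi.eq_or_lt with h1 | h1
  · have ht : t = 0 := by simp [t, xi0, h1]
    simp [ht] at key
  · nlinarith [mul_nonneg (by linarith : 0 ≤ (z ⟨0, hn⟩).re + 1) (sq_nonneg (2 * t - 1))]
end

section
/- For z ∈ ℂⁿ define the operator U(z) := (1/2)·(a(e₁) + b(e₁)) ∘ (a(z) + b(z̄)) on Λ, where z̄ is the componentwise complex conjugate of z and e₁ := (1,0,…,0). Then U(z)(1) = (−z₁)·1 + Σ_{j=2}ⁿ z_j · ι(e₁)·ι(e_j), and U(z)(ι(e₁)) = (−conj(z₁))·ι(e₁) + Σ_{j=2}ⁿ z_j · ι(e_j), where e_j denotes the j-th standard basis vector of ℂⁿ. (This computes the first column of the complex spin representation of u(z), showing q∘u = ι: on the even part u(z)·1 = (−z₁, z₂, …, z_n, 0, …, 0) and on the odd part u(z)·e₁ = (−z̄₁,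 z₂, …, z_n, 0, …, 0) in the respective bases.) -/
/-- The linear functional `φ_v(w) = ∑_j v_j w_j` on `ℂⁿ`. -/
noncomputable def phiDual (n : ℕ) (v : Fin n → ℂ) : Module.Dual ℂ (Fin n → ℂ) :=
  ∑ j, v j • (LinearMap.proj j : (Fin n → ℂ) →ₗ[ℂ] ℂ)

/-- The creation operator `a(v)(x) = √2·ι(v)·x` on the exterior algebra `Λ` of `ℂⁿ`. -/
noncomputable def creation (n : ℕ) (v : Fin n → ℂ) :
    ExteriorAlgebra ℂ (Fin n → ℂ) →ₗ[ℂ] ExteriorAlgebra ℂ (Fin n → ℂ) :=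
  (Real.sqrt 2 : ℂ) • LinearMap.mulLeft ℂ (ExteriorAlgebra.ι ℂ v)

/-- The annihilation operator `b(v)(x) = −√2·(φ_v ⌟ x)` on the exterior algebra `Λ` of `ℂⁿ`,
where `⌟` is left contraction by the linear functional `φ_v`. -/
noncomputable def annihilation (n : ℕ) (v : Fin n → ℂ) :
    ExteriorAlgebra ℂ (Fin n → ℂ) →ₗ[ℂ] ExteriorAlgebra ℂ (Fin n → ℂ) :=
  (-(Real.sqrt 2 : ℂ)) • CliffordAlgebra.contractLeft (phiDual n v)

/-- The first standard basis vector `e₁ = (1,0,…,0)` of `ℂⁿ`. -/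
noncomputable def e₁ (n : ℕ) : Fin n → ℂ := fun j => if j.1 = 0 then 1 else 0

/-- `U(z) := (1/2)·(a(e₁) + b(e₁)) ∘ (a(z) + b(z̄))` on the exterior algebra of `ℂⁿ`. -/
noncomputable def Uop (n : ℕ) (z : Fin n → ℂ) :
    ExteriorAlgebra ℂ (Fin n → ℂ) →ₗ[ℂ] ExteriorAlgebra ℂ (Fin n → ℂ) :=
  (1/2 : ℂ) • ((creation n (e₁ n) + annihilation n (e₁ n)) ∘ₗ
    (creation n z + annihilation n (fun j => (starRingEnd ℂ) (z j))))

open CliffordAlgebra in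
/-- The factors `√2` in the creation and annihilation operators cancel the factor `1/2`. -/
lemma Uop_apply (n : ℕ) (z : Fin n → ℂ) (x : ExteriorAlgebra ℂ (Fin n → ℂ)) :
    Uop n z x =
      ExteriorAlgebra.ι ℂ (e₁ n) * (ExteriorAlgebra.ι ℂ z * x -
        contractLeft (phiDual n fun j => (starRingEnd ℂ) (z j)) x) -
      contractLeft (phiDual n (e₁ n)) (ExteriorAlgebra.ι ℂ z * x -
        contractLeft (phiDual n fun j => (starRingEnd ℂ) (z j)) x) := by
  have h2 : (Real.sqrt 2 : ℂ) * (Real.sqrt 2 : ℂ) = 2 := by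
    rw [← Complex.ofReal_mul, Real.mul_self_sqrt (by norm_num)]
    norm_num
  have factor : ∀ v w y, (creation n v + annihilation n w) y =
      (Real.sqrt 2 : ℂ) • (ExteriorAlgebra.ι ℂ v * y - contractLeft (phiDual n w) y) := by
    intro v w y
    simp only [creation, annihilation, LinearMap.add_apply, LinearMap.smul_apply,
      LinearMap.mulLeft_apply, neg_smul, smul_sub, ← sub_eq_add_neg]
  rw [Uop, LinearMap.smul_apply, LinearMap.comp_apply, factor, factor, mul_smul_comm, map_smul,
    ← smul_sub, smul_smul, smul_smul, mul_assoc, h2]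
  norm_num

lemma phiDual_apply (n : ℕ) (v w : Fin n → ℂ) : phiDual n v w = ∑ j, v j * w j := by
  simp [phiDual]

lemma e₁_eq_single (n : ℕ) (hn : 1 ≤ n) : e₁ n = Pi.single (⟨0, hn⟩ : Fin n) 1 := by
  ext j
  simp [e₁, Pi.single_apply, Fin.ext_iff]

lemma phiDual_e₁_left (n : ℕ) (hn : 1 ≤ n) (w : Fin n → ℂ) :
    phiDual n (e₁ n) w = w ⟨0, hn⟩ := by
  simp [phiDual_apply, e₁_eq_single n hn, Pi.single_apply]

lemma phiDual_e₁_right (n : ℕ) (hn : 1 ≤ n) (v : Fin n → ℂ) :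
    phiDual n v (e₁ n) = v ⟨0, hn⟩ := by
  simp [phiDual_apply, e₁_eq_single n hn, Pi.single_apply]

/-- Expansion of `ι(z)` in the standard basis, with the first term split off. -/
lemma ι_eq_add_sum_erase (n : ℕ) (hn : 1 ≤ n) (z : Fin n → ℂ) :
    ExteriorAlgebra.ι ℂ z = z ⟨0, hn⟩ • ExteriorAlgebra.ι ℂ (e₁ n) +
      ∑ j ∈ Finset.univ.erase (⟨0, hn⟩ : Fin n), z j • ExteriorAlgebra.ι ℂ (Pi.single j 1) := by
  conv_lhs => rw [pi_eq_sum_univ' z, map_sum]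
  rw [← Finset.add_sum_erase _ _ (Finset.mem_univ (⟨0, hn⟩ : Fin n)), e₁_eq_single n hn]
  simp only [map_smul]

/-- `U(z)(1) = (−z₁)·1 + ∑_{j≥2} z_j·ι(e₁)ι(e_j)` and
`U(z)(ι(e₁)) = (−conj z₁)·ι(e₁) + ∑_{j≥2} z_j·ι(e_j)`. -/
theorem stmt18 (n : ℕ) (hn : 1 ≤ n) (z : Fin n → ℂ) :
    Uop n z 1 =
      (-(z ⟨0, hn⟩)) • (1 : ExteriorAlgebra ℂ (Fin n → ℂ)) +
        ∑ j ∈ Finset.univ.erase (⟨0, hn⟩ : Fin n),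
          z j • (ExteriorAlgebra.ι ℂ (e₁ n) * ExteriorAlgebra.ι ℂ (Pi.single j 1)) ∧
    Uop n z (ExteriorAlgebra.ι ℂ (e₁ n)) =
      (-((starRingEnd ℂ) (z ⟨0, hn⟩))) • ExteriorAlgebra.ι ℂ (e₁ n) +
        ∑ j ∈ Finset.univ.erase (⟨0, hn⟩ : Fin n),
          z j • ExteriorAlgebra.ι ℂ (Pi.single j 1) := by
  constructor
  · rw [Uop_apply, mul_one, CliffordAlgebra.contractLeft_one, sub_zero,
      CliffordAlgebra.contractLeft_ι, phiDual_e₁_left n hn, Algebra.algebraMap_eq_smul_one]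
    conv_lhs => rw [ι_eq_add_sum_erase n hn z]
    simp only [mul_add, Finset.mul_sum, mul_smul_comm, ExteriorAlgebra.ι_sq_zero, smul_zero,
      zero_add, neg_smul]
    abel
  · have h : ExteriorAlgebra.ι ℂ (e₁ n) *
        (ExteriorAlgebra.ι ℂ z * ExteriorAlgebra.ι ℂ (e₁ n)) = 0 := by
      rw [eq_neg_of_add_eq_zero_left (ExteriorAlgebra.ι_add_mul_swap z (e₁ n)), mul_neg,
        ← mul_assoc, ExteriorAlgebra.ι_sq_zero, zero_mul, neg_zero]
    rw [Uop_apply, CliffordAlgebra.contractLeft_ι, phiDual_e₁_right n hn, mul_sub, h, map_sub,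
      CliffordAlgebra.contractLeft_ι_mul, CliffordAlgebra.contractLeft_ι,
      CliffordAlgebra.contractLeft_algebraMap, phiDual_e₁_left n hn, phiDual_e₁_left n hn]
    have h1 : e₁ n ⟨0, hn⟩ = 1 := by simp [e₁]
    rw [h1, map_one, mul_one, Algebra.algebraMap_eq_smul_one, mul_smul_comm, mul_one]
    conv_lhs => rw [ι_eq_add_sum_erase n hn z]
    rw [neg_smul]
    abel
end
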